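/- arXiv:0811.4163 — 2 statements merged into one kernel-verified Lean document; each statement's English description precedes it below -/
import Mathlib

section
/- For every prime power q and every n ≥ 1, the volume V_I(r,t) of a ball of injection radius t ≤ ⌊n/2⌋ centered at any r-dimensional subspace of GF(q)^n satisfies q^{t(n-t)} ≤ V_I(r,t) < θ(q)(2θ(q)-1) K_q^{-2} q^{t(n-t)}; in particular the bounds are independent of r. -/
open Module

/-- `K_q = ∏_{j=1}^∞ (1 - q^{-j})`. -/
noncomputable def Kq (q : ℕ) : ℝ := ∏' j : ℕ, (1 - ((q : ℝ))⁻¹ ^ (j + 1))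

/-- `θ(q) = ∑_{m=0}^∞ q^{-m²}`. -/
noncomputable def theta (q : ℕ) : ℝ := ∑' m : ℕ, ((q : ℝ))⁻¹ ^ (m * m)

/-- The injection distance `d_I(U,V) = max{dim U, dim V} - dim(U∩V)`. -/
noncomputable def dI {F : Type} [Field F] {n : ℕ} (U V : Submodule F (Fin n → F)) : ℕ :=
  max (Module.finrank F ↥U) (Module.finrank F ↥V) - Module.finrank F ↥(U ⊓ V)

section Analysis

open Finset

variable {q : ℕ}

theorem inv_natCast_pos (hq : 2 ≤ q) : 0 < ((q : ℝ))⁻¹ := by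
  have : 0 < q := by omega
  positivity

theorem inv_natCast_lt_one (hq : 2 ≤ q) : ((q : ℝ))⁻¹ < 1 :=
  inv_lt_one_of_one_lt₀ (by exact_mod_cast hq)

theorem one_sub_inv_pow_pos (hq : 2 ≤ q) (j : ℕ) : 0 < 1 - ((q : ℝ))⁻¹ ^ (j + 1) :=
  sub_pos.2 (pow_lt_one₀ (inv_natCast_pos hq).le (inv_natCast_lt_one hq) j.succ_ne_zero)

theorem summable_inv_pow_succ (hq : 2 ≤ q) : Summable fun j : ℕ ↦ ((q : ℝ))⁻¹ ^ (j + 1) :=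
  (summable_nat_add_iff 1).2
    (summable_geometric_of_lt_one (inv_natCast_pos hq).le (inv_natCast_lt_one hq))

theorem multipliable_Kq (hq : 2 ≤ q) : Multipliable fun j : ℕ ↦ 1 - ((q : ℝ))⁻¹ ^ (j + 1) := by
  have h := Real.multipliable_one_add_of_summable (summable_inv_pow_succ hq).neg
  simpa [sub_eq_add_neg] using h

theorem Kq_le_prod_range (hq : 2 ≤ q) (k : ℕ) :
    Kq q ≤ ∏ j ∈ range k, (1 - ((q : ℝ))⁻¹ ^ (j + 1)) := by
  refine Antitone.le_of_tendsto (antitone_nat_of_succ_le fun n ↦ ?_)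
    (multipliable_Kq hq).hasProd.tendsto_prod_nat k
  rw [prod_range_succ]
  refine mul_le_of_le_one_right (prod_nonneg fun j _ ↦ (one_sub_inv_pow_pos hq j).le) ?_
  have := pow_pos (inv_natCast_pos hq) (n + 1)
  linarith

theorem Kq_pos (hq : 2 ≤ q) : 0 < Kq q := by
  refine lt_of_le_of_ne ?_ (Ne.symm ?_)
  · exact ge_of_tendsto' (multipliable_Kq hq).hasProd.tendsto_prod_nat
      fun n ↦ prod_nonneg fun j _ ↦ (one_sub_inv_pow_pos hq j).le
  · have h := tprod_one_add_ne_zero_of_summable (f := fun j : ℕ ↦ -((q : ℝ))⁻¹ ^ (j + 1))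
      (fun j ↦ by have := one_sub_inv_pow_pos hq j; rw [← sub_eq_add_neg]; exact this.ne')
      (by simpa using summable_inv_pow_succ hq)
    simpa [Kq, sub_eq_add_neg] using h

theorem sum_range_lt_theta (hq : 2 ≤ q) (T : ℕ) :
    ∑ m ∈ range T, ((q : ℝ))⁻¹ ^ (m * m) < theta q := by
  have hx := inv_natCast_pos hq
  have hs : Summable fun m : ℕ ↦ ((q : ℝ))⁻¹ ^ (m * m) :=
    (summable_geometric_of_lt_one hx.le (inv_natCast_lt_one hq)).of_nonneg_of_le
      (fun m ↦ by positivity)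
      fun m ↦ pow_le_pow_of_le_one hx.le (inv_natCast_lt_one hq).le (Nat.le_mul_self m)
  have h := hs.sum_le_tsum (range (T + 1)) fun m _ ↦ by positivity
  rw [sum_range_succ] at h
  have : 0 < ((q : ℝ))⁻¹ ^ (T * T) := by positivity
  unfold theta
  linarith

/-- Splitting along the diagonal uses `i² + j² - i j ≥ min(i, j)² + (i - j)²`. -/
theorem sum_sum_pow_le {x : ℝ} (hx : 0 < x) (hx1 : x ≤ 1) (T : ℕ) :
    ∑ i ∈ range (T + 1), ∑ j ∈ range (T + 1), x ^ (i * i + j * j - i * j) ≤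
      (∑ m ∈ range (T + 1), x ^ (m * m)) * (2 * ∑ m ∈ range (T + 1), x ^ (m * m) - 1) := by
  set S := ∑ m ∈ range (T + 1), x ^ (m * m) with hS
  have tail (N a : ℕ) (ha : a + N ≤ T + 1) :
      ∑ k ∈ range N, x ^ ((a + k) * (a + k)) ≤ ∑ k ∈ Ico a (T + 1), x ^ (k * k) := by
    rw [sum_Ico_eq_sum_range]
    exact sum_le_sum_of_subset_of_nonneg (range_subset_range.2 (by omega))
      fun _ _ _ ↦ by positivity
  have hS1 : ∑ k ∈ Ico 1 (T + 1), x ^ (k * k) = S - 1 := by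
    rw [hS, range_eq_Ico, sum_eq_sum_Ico_succ_bot (Nat.succ_pos T)]
    simp
  have lower (j : ℕ) (hj : j ∈ range (T + 1)) :
      ∑ i ∈ Ico j (T + 1), x ^ (i * i + j * j - i * j) ≤ x ^ (j * j) * S := by
    rw [mem_range] at hj
    rw [sum_Ico_eq_sum_range]
    calc _ ≤ ∑ k ∈ range (T + 1 - j), x ^ (j * j) * x ^ ((0 + k) * (0 + k)) := by
          refine sum_le_sum fun k _ ↦ ?_
          rw [← pow_add]
          refine pow_le_pow_of_le_one hx.le hx1 (Nat.le_sub_of_add_le ?_)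
          nlinarith [Nat.zero_le (j * k)]
      _ ≤ _ := by
          rw [← mul_sum]
          refine mul_le_mul_of_nonneg_left ((tail _ 0 (by omega)).trans ?_) (by positivity)
          rw [hS, range_eq_Ico]
  have upper (i : ℕ) (hi : i ∈ range (T + 1)) :
      ∑ j ∈ Ico (i + 1) (T + 1), x ^ (i * i + j * j - i * j) ≤ x ^ (i * i) * (S - 1) := by
    rw [mem_range] at hi
    rw [sum_Ico_eq_sum_range]
    calc _ ≤ ∑ k ∈ range (T + 1 - (i + 1)), x ^ (i * i) * x ^ ((1 + k) * (1 + k)) := by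
          refine sum_le_sum fun k _ ↦ ?_
          rw [← pow_add]
          refine pow_le_pow_of_le_one hx.le hx1 (Nat.le_sub_of_add_le ?_)
          nlinarith [Nat.zero_le (i * k)]
      _ ≤ _ := by
          rw [← mul_sum, ← hS1]
          exact mul_le_mul_of_nonneg_left (tail _ 1 (by omega)) (by positivity)
  have split (i : ℕ) (hi : i ∈ range (T + 1)) :
      ∑ j ∈ range (T + 1), x ^ (i * i + j * j - i * j) =
        ∑ j ∈ range (i + 1), x ^ (i * i + j * j - i * j) +
          ∑ j ∈ Ico (i + 1) (T + 1), x ^ (i * i + j * j - i * j) :=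
    (sum_range_add_sum_Ico _ (by simpa using hi)).symm
  rw [sum_congr rfl split, sum_add_distrib]
  have swap : ∑ i ∈ range (T + 1), ∑ j ∈ range (i + 1), x ^ (i * i + j * j - i * j) =
      ∑ j ∈ range (T + 1), ∑ i ∈ Ico j (T + 1), x ^ (i * i + j * j - i * j) :=
    sum_comm' fun i j ↦ by simp only [mem_range, mem_Ico]; omega
  have h1 := sum_le_sum lower
  have h2 := sum_le_sum upper
  rw [← sum_mul, ← hS] at h1 h2
  rw [swap]
  linarith

theorem sum_sum_pow_lt_theta (hq : 2 ≤ q) (T : ℕ) :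
    ∑ i ∈ range (T + 1), ∑ j ∈ range (T + 1), ((q : ℝ))⁻¹ ^ (i * i + j * j - i * j) <
      theta q * (2 * theta q - 1) := by
  refine (sum_sum_pow_le (inv_natCast_pos hq) (inv_natCast_lt_one hq).le T).trans_lt ?_
  have h := sum_range_lt_theta hq (T + 1)
  have h1 : 1 ≤ ∑ m ∈ range (T + 1), ((q : ℝ))⁻¹ ^ (m * m) := by
    have := inv_natCast_pos hq
    rw [sum_range_succ']
    have : 0 ≤ ∑ m ∈ range T, ((q : ℝ))⁻¹ ^ ((m + 1) * (m + 1)) := by positivity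
    simpa using this
  nlinarith

end Analysis

section Product

variable {F V C : Type*} [Field F] [AddCommGroup V] [Module F V] [AddCommGroup C] [Module F C]

theorem finrank_inf_range_inl (W : Submodule F (V × C)) :
    finrank F ↥(LinearMap.range (LinearMap.inl F V C) ⊓ W) =
      finrank F (W.comap (LinearMap.inl F V C)) := by
  rw [← Submodule.map_comap_eq]
  exact (Submodule.equivMapOfInjective _ LinearMap.inl_injective _).finrank_eq.symm

theorem finrank_eq_comap_inl_add_map_snd [Finite V] [Finite C] (W : Submodule F (V × C)) :
    finrank F W = finrank F (W.comap (LinearMap.inl F V C)) +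
      finrank F (W.map (LinearMap.snd F V C)) := by
  rw [← LinearMap.finrank_range_add_finrank_ker ((LinearMap.snd F V C).domRestrict W), add_comm,
    LinearMap.range_domRestrict]
  congr 1
  refine LinearEquiv.finrank_eq (LinearEquiv.symm (LinearEquiv.ofBijective
    (((LinearMap.inl F V C).restrict (p := W.comap (LinearMap.inl F V C)) (q := W)
      fun _ h ↦ h).codRestrict _ fun x ↦ ?_) ⟨?_, ?_⟩))
  · simp [LinearMap.mem_ker]
  · intro x y h
    have := congrArg (fun z ↦ z.1.1.1) h
    exact Subtype.ext this
  · rintro ⟨⟨⟨u, c⟩, hw⟩, h⟩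
    obtain rfl : c = 0 := by simpa [LinearMap.mem_ker] using h
    exact ⟨⟨u, hw⟩, rfl⟩

theorem sum_finrank_submodule [Finite V] [Fintype (Submodule F V)] (g : ℕ → ℕ) :
    ∑ A : Submodule F V, g (finrank F A) = ∑ k ∈ Finset.range (finrank F V + 1),
      Nat.card {W : Submodule F V // finrank F W = k} * g k := by
  classical
  rw [← Finset.sum_fiberwise_of_maps_to' (t := Finset.range (finrank F V + 1))
    (g := fun A : Submodule F V ↦ finrank F A)
    fun A _ ↦ Finset.mem_range.2 (Nat.lt_succ_of_le A.finrank_le)]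
  refine Finset.sum_congr rfl fun k _ ↦ ?_
  rw [Finset.sum_const, smul_eq_mul, Nat.card_eq_fintype_card, Fintype.card_subtype]

end Product

section Counting

variable {F V : Type*} [Field F] [Fintype F] [AddCommGroup V] [Module F V] [Finite V]

/-- Counting linearly independent `k`-tuples by the subspace they span. -/
theorem card_subspaces_mul_prod {k : ℕ} (hk : k ≤ finrank F V) :
    Nat.card {W : Submodule F V // finrank F W = k} *
        ∏ i : Fin k, (Fintype.card F ^ k - Fintype.card F ^ i.val) =
      ∏ i : Fin k, (Fintype.card F ^ finrank F V - Fintype.card F ^ i.val) := by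
  have hspan (W : Submodule F V) (hW : finrank F W = k) (s : Fin k → W)
      (hs : LinearIndependent F s) : Submodule.span F (Set.range fun i ↦ (s i : V)) = W := by
    have h := hs.span_eq_top_of_card_eq_finrank' (by simpa using hW.symm)
    have h' := congrArg (Submodule.map W.subtype) h
    rwa [Submodule.map_span, ← Set.range_comp, Submodule.map_subtype_top] at h'
  let f : (Σ W : {W : Submodule F V // finrank F W = k},
      {s : Fin k → W.1 // LinearIndependent F s}) → {s : Fin k → V // LinearIndependent F s} :=
    fun p ↦ ⟨fun i ↦ (p.2.1 i : V), p.2.2.map' p.1.1.subtype p.1.1.ker_subtype⟩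
  have hf : Function.Bijective f := by
    constructor
    · rintro ⟨⟨W, hW⟩, s, hs⟩ ⟨⟨W', hW'⟩, s', hs'⟩ h
      have h' : (fun i ↦ (s i : V)) = fun i ↦ (s' i : V) := congrArg Subtype.val h
      obtain rfl : W = W' := by rw [← hspan W hW s hs, ← hspan W' hW' s' hs', h']
      obtain rfl : s = s' := funext fun i ↦ Subtype.ext (congrFun h' i)
      rfl
    · rintro ⟨s, hs⟩
      exact ⟨⟨⟨Submodule.span F (Set.range s), (finrank_span_eq_card hs).trans (Fintype.card_fin k)⟩,
          _, linearIndependent_span hs⟩,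
        Subtype.ext rfl⟩
  have := Fintype.ofFinite {W : Submodule F V // finrank F W = k}
  rw [← card_linearIndependent hk, ← Nat.card_congr (Equiv.ofBijective f hf), Nat.card_sigma]
  rw [Finset.sum_congr rfl fun W _ ↦ by
    rw [card_linearIndependent (K := F) (V := W.1) (k := k) W.2.ge, W.2]]
  simp [Nat.card_eq_fintype_card]

variable {C : Type*} [AddCommGroup C] [Module F C] [Finite C]

/-- Subspaces of `V × C` with given intersection with `V` and given projection to `C`. -/
theorem card_comap_inl_map_snd (A : Submodule F V) (B : Submodule F C) :
    Nat.card {W : Submodule F (V × C) //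
        W.comap (LinearMap.inl F V C) = A ∧ W.map (LinearMap.snd F V C) = B} =
      Fintype.card F ^ ((finrank F V - finrank F A) * finrank F B) := by
  let g (φ : B →ₗ[F] V ⧸ A) : Submodule F (V × C) :=
    (LinearMap.range (φ.prod B.subtype)).comap (A.mkQ.prodMap LinearMap.id)
  have mem_g (φ : B →ₗ[F] V ⧸ A) (u : V) (c : C) :
      (u, c) ∈ g φ ↔ ∃ b : B, φ b = A.mkQ u ∧ (b : C) = c := by
    simp [g, LinearMap.mem_range, Prod.ext_iff]
  have hg (φ : B →ₗ[F] V ⧸ A) : (g φ).comap (LinearMap.inl F V C) = A ∧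
      (g φ).map (LinearMap.snd F V C) = B := by
    constructor
    · ext u
      rw [Submodule.mem_comap, LinearMap.inl_apply, mem_g]
      constructor
      · rintro ⟨b, hb, h0⟩
        obtain rfl : b = 0 := Subtype.ext h0
        rw [map_zero] at hb
        exact (Submodule.Quotient.mk_eq_zero A).1 hb.symm
      · intro hu
        exact ⟨0, by simpa using ((Submodule.Quotient.mk_eq_zero A).2 hu).symm, rfl⟩
    · ext c
      constructor
      · rintro ⟨⟨u, c⟩, hw, rfl⟩
        obtain ⟨b, -, rfl⟩ := (mem_g φ u c).1 hw
        exact b.2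
      · intro hc
        obtain ⟨u, hu⟩ := A.mkQ_surjective (φ ⟨c, hc⟩)
        exact ⟨(u, c), (mem_g φ u c).2 ⟨⟨c, hc⟩, hu.symm, rfl⟩, rfl⟩
  have bij : Function.Bijective fun φ ↦ (⟨g φ, hg φ⟩ : {W : Submodule F (V × C) //
      W.comap (LinearMap.inl F V C) = A ∧ W.map (LinearMap.snd F V C) = B}) := by
    constructor
    · intro φ ψ h
      have h : g φ = g ψ := congrArg Subtype.val h
      ext1 b
      obtain ⟨u, hu⟩ := A.mkQ_surjective (φ b)
      have hm : (u, (b : C)) ∈ g φ := (mem_g φ u b).2 ⟨b, hu.symm, rfl⟩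
      rw [h] at hm
      obtain ⟨b', hb', he⟩ := (mem_g ψ u b).1 hm
      obtain rfl : b' = b := Subtype.ext he
      rw [hb', hu]
    · rintro ⟨W, hA, hB⟩
      let π : W →ₗ[F] B := ((LinearMap.snd F V C).restrict
        (p := W) (q := B) fun w hw ↦ hB ▸ Submodule.mem_map_of_mem hw)
      have hπ : LinearMap.range π = ⊤ := by
        rw [LinearMap.range_eq_top]
        rintro ⟨c, hc⟩
        obtain ⟨w, hw, h⟩ := (hB ▸ hc : c ∈ W.map (LinearMap.snd F V C))
        exact ⟨⟨w, hw⟩, Subtype.ext h⟩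
      obtain ⟨s, hs⟩ := π.exists_rightInverse_of_surjective hπ
      have hs' (b : B) : (s b).1.2 = b := congrArg Subtype.val (LinearMap.congr_fun hs b)
      refine ⟨A.mkQ ∘ₗ LinearMap.fst F V C ∘ₗ W.subtype ∘ₗ s, Subtype.ext ?_⟩
      have key (b : B) (u : V) : A.mkQ (s b).1.1 = A.mkQ u ↔ (u, (b : C)) ∈ W := by
        have hd : (u, (b : C)) - (s b).1 = LinearMap.inl F V C (u - (s b).1.1) := by
          ext <;> simp [hs']
        rw [eq_comm, Submodule.mkQ_apply, Submodule.mkQ_apply, Submodule.Quotient.eq, ← hA,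
          Submodule.mem_comap, ← hd]
        exact ⟨fun h ↦ by simpa using W.add_mem h (s b).2, fun h ↦ W.sub_mem h (s b).2⟩
      ext ⟨u, c⟩
      rw [mem_g]
      constructor
      · rintro ⟨b, hb, rfl⟩
        exact (key b u).1 hb
      · intro hw
        have hc : c ∈ B := hB ▸ Submodule.mem_map_of_mem (f := LinearMap.snd F V C) hw
        exact ⟨⟨c, hc⟩, (key ⟨c, hc⟩ u).2 hw, rfl⟩
  rw [← Nat.card_congr (Equiv.ofBijective _ bij), Module.natCard_eq_pow_finrank (K := F),
    Module.finrank_linearMap, Submodule.finrank_quotient, Nat.card_eq_fintype_card, mul_comm]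

end Counting

section Gaussian

variable {F V : Type*} [Field F] [Fintype F] [AddCommGroup V] [Module F V] [Finite V]

theorem pow_le_card_subspaces {k : ℕ} (hk : k ≤ finrank F V) :
    Fintype.card F ^ (k * (finrank F V - k)) ≤
      Nat.card {W : Submodule F V // finrank F W = k} := by
  have hq : 1 < Fintype.card F := Fintype.one_lt_card
  have hpos : 0 < ∏ i : Fin k, (Fintype.card F ^ k - Fintype.card F ^ i.val) :=
    Finset.prod_pos fun i _ ↦ Nat.sub_pos_of_lt (Nat.pow_lt_pow_right hq i.2)
  refine le_of_mul_le_mul_right ?_ hpos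
  rw [card_subspaces_mul_prod hk, mul_comm k, pow_mul]
  have hc : (Fintype.card F ^ (finrank F V - k)) ^ k =
      ∏ _i : Fin k, Fintype.card F ^ (finrank F V - k) := by simp
  rw [hc, ← Finset.prod_mul_distrib]
  refine Finset.prod_le_prod' fun i _ ↦ ?_
  rw [Nat.mul_sub, ← pow_add, Nat.sub_add_cancel hk]
  exact Nat.sub_le_sub_left (Nat.le_mul_of_pos_left _ (by positivity)) _

theorem card_subspaces_le {k : ℕ} (hk : k ≤ finrank F V) :
    (Nat.card {W : Submodule F V // finrank F W = k} : ℝ) ≤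
      (Kq (Fintype.card F))⁻¹ * (Fintype.card F : ℝ) ^ (k * (finrank F V - k)) := by
  set q := Fintype.card F with hqdef
  have hq : 2 ≤ q := Fintype.one_lt_card
  have hq0 : (0 : ℝ) < q := by positivity
  have hprod : ((∏ i : Fin k, (q ^ k - q ^ i.val) : ℕ) : ℝ) =
      (q : ℝ) ^ (k * k) * ∏ j ∈ Finset.range k, (1 - ((q : ℝ))⁻¹ ^ (j + 1)) := by
    rw [Fin.prod_univ_eq_prod_range fun i ↦ q ^ k - q ^ i, Nat.cast_prod, pow_mul,
      ← Finset.prod_range_reflect]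
    conv_rhs => rw [← Finset.card_range k, ← Finset.prod_const, Finset.card_range,
      ← Finset.prod_mul_distrib]
    refine Finset.prod_congr rfl fun j hj ↦ ?_
    rw [Finset.mem_range] at hj
    rw [Nat.cast_sub (Nat.pow_le_pow_right (by omega) (by omega)), mul_sub, mul_one,
      Nat.cast_pow, Nat.cast_pow, inv_pow, ← div_eq_mul_inv]
    congr 1
    rw [eq_div_iff (by positivity), ← pow_add]
    congr 1
    omega
  have h := congrArg (Nat.cast : ℕ → ℝ) (card_subspaces_mul_prod (F := F) (V := V) hk)
  rw [Nat.cast_mul, ← hqdef, hprod] at h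
  have hle : ((∏ i : Fin k, (q ^ finrank F V - q ^ i.val) : ℕ) : ℝ) ≤
      (q : ℝ) ^ (k * (finrank F V - k)) * (q : ℝ) ^ (k * k) := by
    rw [← pow_add, ← Nat.mul_add, Nat.sub_add_cancel hk]
    have : ∏ i : Fin k, (q ^ finrank F V - q ^ i.val) ≤ ∏ _i : Fin k, q ^ finrank F V :=
      Finset.prod_le_prod' fun i _ ↦ Nat.sub_le _ _
    rw [Finset.prod_const, Finset.card_univ, Fintype.card_fin, ← pow_mul, mul_comm] at this
    exact_mod_cast this
  rw [← h] at hle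
  rw [inv_mul_eq_div, le_div_iff₀ (Kq_pos hq)]
  refine le_of_mul_le_mul_right (le_trans ?_ hle) (by positivity : 0 < (q : ℝ) ^ (k * k))
  have := mul_le_mul_of_nonneg_left (Kq_le_prod_range hq k)
    (by positivity : 0 ≤ (Nat.card {W : Submodule F V // finrank F W = k} : ℝ) * (q : ℝ) ^ (k * k))
  linarith

variable {C : Type*} [AddCommGroup C] [Module F C] [Finite C]

theorem card_submodule_prod (P : ℕ → ℕ → Prop) [∀ a b, Decidable (P a b)] :
    Nat.card {W : Submodule F (V × C) // P (finrank F (W.comap (LinearMap.inl F V C)))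
        (finrank F (W.map (LinearMap.snd F V C)))} =
      ∑ k ∈ Finset.range (finrank F V + 1), Nat.card {A : Submodule F V // finrank F A = k} *
        ∑ b ∈ Finset.range (finrank F C + 1), Nat.card {B : Submodule F C // finrank F B = b} *
          if P k b then Fintype.card F ^ ((finrank F V - k) * b) else 0 := by
  classical
  have := Fintype.ofFinite (Submodule F V)
  have := Fintype.ofFinite (Submodule F C)
  have := Fintype.ofFinite (Submodule F (V × C))
  rw [← sum_finrank_submodule (fun k ↦ ∑ b ∈ Finset.range (finrank F C + 1),
    Nat.card {B : Submodule F C // finrank F B = b} *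
      if P k b then Fintype.card F ^ ((finrank F V - k) * b) else 0)]
  simp_rw [← sum_finrank_submodule (V := C)
    (fun b ↦ if P _ b then Fintype.card F ^ ((finrank F V - _) * b) else 0)]
  rw [Nat.card_eq_fintype_card, Fintype.card_subtype, Finset.card_filter,
    ← Finset.sum_fiberwise' Finset.univ
      (fun W : Submodule F (V × C) ↦
        (W.comap (LinearMap.inl F V C), W.map (LinearMap.snd F V C)))
      (fun p ↦ if P (finrank F p.1) (finrank F p.2) then 1 else 0),
    Fintype.sum_prod_type]
  refine Finset.sum_congr rfl fun A _ ↦ Finset.sum_congr rfl fun B _ ↦ ?_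
  rw [Finset.sum_const, ← card_comap_inl_map_snd A B, Nat.card_eq_fintype_card,
    Fintype.card_subtype]
  simp only [Prod.mk.injEq, smul_eq_mul, mul_ite, mul_one, mul_zero]

theorem card_injection_ball {F : Type} [Field F] [Fintype F] {n : ℕ} (t : ℕ)
    (U : Submodule F (Fin n → F)) :
    ∃ C : Submodule F (Fin n → F), finrank F U + finrank F C = n ∧
      Nat.card {W : Submodule F (Fin n → F) // dI U W ≤ t} =
        ∑ k ∈ Finset.range (finrank F U + 1), Nat.card {A : Submodule F U // finrank F A = k} *
          ∑ b ∈ Finset.range (finrank F C + 1), Nat.card {B : Submodule F C // finrank F B = b} *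
            if finrank F U - k ≤ t ∧ b ≤ t then
              Fintype.card F ^ ((finrank F U - k) * b) else 0 := by
  obtain ⟨C, hC⟩ := U.exists_isCompl
  refine ⟨C, by simpa using Submodule.finrank_add_eq_of_isCompl hC, ?_⟩
  rw [← card_submodule_prod fun k b ↦ finrank F U - k ≤ t ∧ b ≤ t]
  let e := Submodule.prodEquivOfIsCompl U C hC
  have hU : (LinearMap.range (LinearMap.inl F U C)).map e.toLinearMap = U := by
    rw [← LinearMap.range_comp]
    have : e.toLinearMap ∘ₗ LinearMap.inl F U C = U.subtype := by
      ext u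
      simp [e]
    rw [this, Submodule.range_subtype]
  refine (Nat.card_congr ((Submodule.orderIsoMapComap e).toEquiv.subtypeEquiv fun W ↦ ?_)).symm
  have h1 : finrank F (W.map e.toLinearMap) = finrank F W := e.finrank_map_eq W
  have h2 : finrank F ↥(U ⊓ W.map e.toLinearMap) =
      finrank F (W.comap (LinearMap.inl F U C)) := by
    have hUW : U ⊓ W.map e.toLinearMap =
        (LinearMap.range (LinearMap.inl F U C) ⊓ W).map e.toLinearMap := by
      rw [Submodule.map_inf _ e.injective, hU]
    rw [hUW, ← finrank_inf_range_inl]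
    exact e.finrank_map_eq _
  have h3 := finrank_eq_comap_inl_add_map_snd W
  have h4 : finrank F (W.comap (LinearMap.inl F U C)) ≤ finrank F U := Submodule.finrank_le _
  change _ ↔ dI U (W.map e.toLinearMap) ≤ t
  rw [dI, h1, h2]
  omega

end Gaussian

section Exponents

theorem exponent_add_le {r s t k l : ℕ} (ht : 2 * t ≤ r + s) (hk : k ≤ r) (hl : l ≤ s)
    (hkt : r - k ≤ t) (hlt : s - l ≤ t) :
    k * (r - k) + (s - l) * l + (r - k) * (s - l) +
      ((k - (r - t)) * (k - (r - t)) + (l - (s - t)) * (l - (s - t)) -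
        (k - (r - t)) * (l - (s - t))) ≤ t * (r + s - t) := by
  obtain ⟨a, rfl⟩ := Nat.exists_eq_add_of_le hk
  obtain ⟨b, rfl⟩ := Nat.exists_eq_add_of_le hl
  simp only [Nat.add_sub_cancel_left] at *
  have hij (i j : ℕ) : i * j ≤ i * i + j * j := by nlinarith [sq_nonneg ((i : ℤ) - j)]
  have hcases : (t ≤ k + a ∧ t ≤ l + b) ∨ (t ≤ k + a ∧ l + b ≤ t) ∨ (k + a ≤ t ∧ t ≤ l + b) := by
    omega
  rcases hcases with ⟨h, h'⟩ | ⟨h, h'⟩ | ⟨h, h'⟩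
  all_goals
    generalize hi : k - (k + a - t) = i
    generalize hj : l - (l + b - t) = j
    zify [hij i j, (by omega : t ≤ k + a + (l + b))]
  · have ha : (a : ℤ) = t - i := by omega
    have hb : (b : ℤ) = t - j := by omega
    have hu : (0 : ℤ) ≤ k - i := by omega
    have hv : (0 : ℤ) ≤ l - j := by omega
    rw [ha, hb]
    nlinarith [mul_nonneg (Int.natCast_nonneg i) hu, mul_nonneg (Int.natCast_nonneg j) hv]
  · have ha : (a : ℤ) = t - i := by omega
    obtain rfl : l = j := by omega
    have hu : (0 : ℤ) ≤ k - i - (t - b - l) := by omega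
    have hv : (0 : ℤ) ≤ t - b - l := by omega
    rw [ha]
    nlinarith [mul_nonneg (Int.natCast_nonneg i) hu, mul_nonneg (Int.natCast_nonneg l) hv]
  · have hb : (b : ℤ) = t - j := by omega
    obtain rfl : k = i := by omega
    have hu : (0 : ℤ) ≤ l - j - (t - a - k) := by omega
    have hv : (0 : ℤ) ≤ t - a - k := by omega
    rw [hb]
    nlinarith [mul_nonneg (Int.natCast_nonneg j) hu, mul_nonneg (Int.natCast_nonneg k) hv]

theorem exponent_min {r s t : ℕ} (ht : 2 * t ≤ r + s) :
    t * (r + s - t) = (r - min r t) * (min r t) + min s t * (s - min s t) + min r t * min s t := by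
  have hcases : (t ≤ r ∧ t ≤ s) ∨ (t ≤ r ∧ s ≤ t) ∨ (r ≤ t ∧ t ≤ s) := by omega
  rcases hcases with ⟨h, h'⟩ | ⟨h, h'⟩ | ⟨h, h'⟩ <;>
    simp only [h, h', min_eq_left, min_eq_right, Nat.sub_self]
  all_goals
    zify [h, h', (by omega : t ≤ r + s)]
    ring

theorem sum_range_ite_le {f : ℕ → ℝ} (hf : ∀ i, 0 ≤ f i) (r t : ℕ) :
    (∑ k ∈ Finset.range (r + 1), if r - k ≤ t then f (k - (r - t)) else 0) ≤
      ∑ i ∈ Finset.range (t + 1), f i := by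
  have h : (Finset.range (r + 1)).filter (fun k ↦ r - k ≤ t) = Finset.Ico (r - t) (r + 1) := by
    ext k
    simp only [Finset.mem_filter, Finset.mem_range, Finset.mem_Ico]
    omega
  rw [← Finset.sum_filter, h, Finset.sum_Ico_eq_sum_range]
  simp only [Nat.add_sub_cancel_left]
  exact Finset.sum_le_sum_of_subset_of_nonneg (Finset.range_subset_range.2 (by omega))
    fun _ _ _ ↦ hf _

end Exponents

theorem injection_ball_volume_bounds (F : Type) [Field F] [Fintype F] (n r t : ℕ)
    (hn : 1 ≤ n) (ht : t ≤ n / 2)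
    (U : Submodule F (Fin n → F)) (hU : finrank F ↥U = r) :
    (Fintype.card F : ℝ) ^ (t * (n - t))
        ≤ (Nat.card {W : Submodule F (Fin n → F) // dI U W ≤ t} : ℝ) ∧
    (Nat.card {W : Submodule F (Fin n → F) // dI U W ≤ t} : ℝ)
        < theta (Fintype.card F) * (2 * theta (Fintype.card F) - 1)
            * ((Kq (Fintype.card F))⁻¹) ^ 2 * (Fintype.card F : ℝ) ^ (t * (n - t)) := by
  obtain ⟨C, hC, hcard⟩ := card_injection_ball t U
  rw [hcard]
  subst hU
  set r := finrank F U with hr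
  set s := finrank F C with hs
  rw [← show t * (r + s - t) = t * (n - t) by rw [hC]]
  have ht2 : 2 * t ≤ r + s := by omega
  set q := Fintype.card F with hqdef
  have hq : 2 ≤ q := Fintype.one_lt_card
  have hq0 : (0 : ℝ) < q := by positivity
  constructor
  · norm_cast
    rw [exponent_min ht2, pow_add, pow_add]
    have hk : r - min r t ≤ r := Nat.sub_le _ _
    have ha : r - (r - min r t) = min r t := Nat.sub_sub_self (min_le_left _ _)
    have hA := pow_le_card_subspaces (F := F) (V := U) hk
    have hB := pow_le_card_subspaces (F := F) (V := C) (min_le_left s t)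
    rw [← hr, ha] at hA
    rw [mul_assoc]
    refine le_trans ?_ (Finset.single_le_sum (fun _ _ ↦ Nat.zero_le _)
      (Finset.mem_range.2 (Nat.lt_succ_of_le hk)))
    refine Nat.mul_le_mul hA (le_trans ?_ (Finset.single_le_sum (fun _ _ ↦ Nat.zero_le _)
      (Finset.mem_range.2 (Nat.lt_succ_of_le (min_le_left s t)))))
    refine Nat.mul_le_mul hB ?_
    rw [ha, if_pos ⟨min_le_right _ _, min_le_right _ _⟩]
  · push_cast
    have hK := inv_pos.2 (Kq_pos hq)
    set M : ℝ := (Kq q)⁻¹ ^ 2 * (q : ℝ) ^ (t * (r + s - t)) with hM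
    have hM0 : 0 < M := by positivity
    let c (i j : ℕ) : ℝ := ((q : ℝ))⁻¹ ^ (i * i + j * j - i * j)
    have hc (i j : ℕ) : 0 ≤ c i j := by positivity
    have term (k l : ℕ) (hk : k ≤ r) (hl : l ≤ s) :
        (Nat.card {A : Submodule F U // finrank F A = k} : ℝ) *
          ((Nat.card {B : Submodule F C // finrank F B = s - l} : ℝ) *
            if r - k ≤ t ∧ s - l ≤ t then (q : ℝ) ^ ((r - k) * (s - l)) else 0) ≤
        M * if r - k ≤ t then (if s - l ≤ t then c (k - (r - t)) (l - (s - t)) else 0) else 0 := by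
      by_cases h : r - k ≤ t ∧ s - l ≤ t
      · rw [if_pos h, if_pos h.1, if_pos h.2]
        have hA := card_subspaces_le (F := F) (V := U) hk
        have hB := card_subspaces_le (F := F) (V := C) (Nat.sub_le s l)
        rw [← hs, Nat.sub_sub_self hl] at hB
        refine (mul_le_mul hA (mul_le_mul_of_nonneg_right hB (by positivity)) (by positivity)
          (by positivity)).trans ?_
        rw [← hqdef, ← hr, hM]
        simp only [c]
        rw [inv_pow (q : ℝ), ← div_eq_mul_inv, le_div_iff₀ (by positivity)]
        have := pow_le_pow_right₀ (by exact_mod_cast one_le_two.trans hq : (1 : ℝ) ≤ q)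
          (exponent_add_le ht2 hk hl h.1 h.2)
        rw [pow_add, pow_add, pow_add] at this
        have := mul_le_mul_of_nonneg_left this (by positivity : 0 ≤ (Kq q)⁻¹ ^ 2)
        linarith
      · have : (if r - k ≤ t then (if s - l ≤ t then c (k - (r - t)) (l - (s - t)) else 0)
            else 0) = 0 := by
          rw [← ite_and, if_neg h]
        rw [if_neg h, this]
        simp
    calc _ = ∑ k ∈ Finset.range (r + 1), ∑ l ∈ Finset.range (s + 1),
          (Nat.card {A : Submodule F U // finrank F A = k} : ℝ) *
            ((Nat.card {B : Submodule F C // finrank F B = s - l} : ℝ) *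
              if r - k ≤ t ∧ s - l ≤ t then (q : ℝ) ^ ((r - k) * (s - l)) else 0) := by
          refine Finset.sum_congr rfl fun k _ ↦ ?_
          rw [Finset.mul_sum, ← Finset.sum_range_reflect]
          simp only [Nat.add_sub_cancel]
      _ ≤ ∑ k ∈ Finset.range (r + 1), ∑ l ∈ Finset.range (s + 1), M *
          if r - k ≤ t then (if s - l ≤ t then c (k - (r - t)) (l - (s - t)) else 0) else 0 :=
          Finset.sum_le_sum fun k hk ↦ Finset.sum_le_sum fun l hl ↦
            term k l (Nat.lt_succ_iff.1 (Finset.mem_range.1 hk))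
              (Nat.lt_succ_iff.1 (Finset.mem_range.1 hl))
      _ = M * ∑ k ∈ Finset.range (r + 1), if r - k ≤ t then
          (∑ l ∈ Finset.range (s + 1), if s - l ≤ t then c (k - (r - t)) (l - (s - t)) else 0)
            else 0 := by
          rw [Finset.mul_sum]
          refine Finset.sum_congr rfl fun k _ ↦ ?_
          rw [← Finset.mul_sum]
          split_ifs <;> simp
      _ ≤ M * ∑ i ∈ Finset.range (t + 1), ∑ j ∈ Finset.range (t + 1), c i j := by
          refine mul_le_mul_of_nonneg_left ?_ hM0.le
          refine (sum_range_ite_le (f := fun i ↦ ∑ l ∈ Finset.range (s + 1),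
            if s - l ≤ t then c i (l - (s - t)) else 0) (fun i ↦ Finset.sum_nonneg fun l _ ↦ ?_)
            r t).trans (Finset.sum_le_sum fun i _ ↦ sum_range_ite_le (hc i) s t)
          split_ifs
          exacts [hc _ _, le_rfl]
      _ < M * (theta q * (2 * theta q - 1)) :=
          mul_lt_mul_of_pos_left (sum_sum_pow_lt_theta hq t) hM0
      _ = _ := by rw [hM]; ring
end

section
/- For n - ⌊n/2⌋ ≤ ρ < n, a single subspace of dimension ⌊n/2⌋ covers the whole projective space E(q,n) with injection radius ρ, so K_I(q,n,ρ) = 1. For odd n = 2m+1, K_I(q,n,m) = 2: the pair {C, C^⊥} with dim C = m has injection covering radius m, but no single subspace does. -/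
open Module

/-- Minimum cardinality of a subspace code in `E(q,n)` with injection covering radius `ρ`. -/
noncomputable def KI (F : Type) [Field F] [Fintype F] (n ρ : ℕ) : ℕ :=
  sInf {m : ℕ | ∃ C : Set (Submodule F (Fin n → F)),
    m = C.ncard ∧ ∀ U : Submodule F (Fin n → F), ∃ V ∈ C, dI U V ≤ ρ}

/-- The linear functional `x ↦ ∑ i, x i * y i` given by the standard dot product. -/
def dotL {F : Type} [Field F] {n : ℕ} (y : Fin n → F) : (Fin n → F) →ₗ[F] F where
  toFun x := ∑ i, x i * y i
  map_add' a b := by simp [add_mul, Finset.sum_add_distrib]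
  map_smul' c a := by simp [Finset.mul_sum, mul_assoc]

/-- The orthogonal complement of `C` with respect to the standard dot product. -/
def perp {F : Type} [Field F] {n : ℕ} (C : Submodule F (Fin n → F)) :
    Submodule F (Fin n → F) :=
  ⨅ y ∈ C, LinearMap.ker (dotL y)

section SubspaceCodes

variable {F : Type} [Field F] {n : ℕ}

lemma finrank_add_finrank_le (U V : Submodule F (Fin n → F)) :
    finrank F U + finrank F V ≤ n + finrank F ↥(U ⊓ V) := by
  have h := Submodule.finrank_sup_add_finrank_inf_eq U V
  have h' := Submodule.finrank_le (U ⊔ V)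
  rw [finrank_fin_fun] at h'
  omega

lemma dI_le_of_finrank_le {U C : Submodule F (Fin n → F)} {r : ℕ} (hC : finrank F C ≤ r)
    (hn : n ≤ finrank F C + r) : dI U C ≤ r := by
  have h := finrank_add_finrank_le U C
  unfold dI
  omega

lemma exists_submodule_finrank_eq {k : ℕ} (hk : k ≤ n) :
    ∃ C : Submodule F (Fin n → F), finrank F C = k := by
  obtain ⟨f, hf⟩ := exists_linearIndependent_of_le_finrank (R := F) (M := Fin n → F) (n := k)
    (by rwa [finrank_fin_fun])
  exact ⟨Submodule.span F (Set.range f), by rw [finrank_span_eq_card hf, Fintype.card_fin]⟩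

lemma perp_eq_orthogonal (C : Submodule F (Fin n → F)) :
    perp C = (Matrix.toBilin' (1 : Matrix (Fin n) (Fin n) F)).orthogonal C := by
  ext x
  simp [perp, dotL, LinearMap.BilinForm.mem_orthogonal_iff,
    Matrix.toBilin'_apply', dotProduct, mul_comm]

lemma finrank_perp (C : Submodule F (Fin n → F)) : finrank F (perp C) = n - finrank F C := by
  rw [perp_eq_orthogonal, LinearMap.BilinForm.finrank_orthogonal, finrank_fin_fun]
  exact LinearMap.BilinForm.nondegenerate_toBilin'_of_det_ne_zero' _ (by simp)

lemma dI_le_or_dI_perp_le {m : ℕ} {C : Submodule F (Fin (2 * m + 1) → F)}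
    (hC : finrank F C = m) (U : Submodule F (Fin (2 * m + 1) → F)) :
    dI U C ≤ m ∨ dI U (perp C) ≤ m := by
  have h := finrank_add_finrank_le U (perp C)
  have hp := finrank_perp C
  unfold dI
  omega

lemma exists_lt_dI {m : ℕ} (C : Submodule F (Fin (2 * m + 1) → F)) :
    ∃ U : Submodule F (Fin (2 * m + 1) → F), m < dI U C := by
  by_cases hC : m < finrank F C
  · exact ⟨⊥, by rw [dI, bot_inf_eq, finrank_bot]; omega⟩
  · obtain ⟨U, hU⟩ := C.exists_isCompl
    have h := Submodule.finrank_add_eq_of_isCompl hU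
    rw [finrank_fin_fun] at h
    refine ⟨U, ?_⟩
    rw [dI, hU.symm.inf_eq_bot, finrank_bot]
    omega

variable [Fintype F]

lemma KI_le_ncard {ρ : ℕ} (C : Set (Submodule F (Fin n → F)))
    (hC : ∀ U, ∃ V ∈ C, dI U V ≤ ρ) : KI F n ρ ≤ C.ncard :=
  Nat.sInf_le ⟨C, rfl, hC⟩

lemma exists_code_ncard_eq_KI (ρ : ℕ) :
    ∃ C : Set (Submodule F (Fin n → F)), C.ncard = KI F n ρ ∧ ∀ U, ∃ V ∈ C, dI U V ≤ ρ := by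
  have hne : {m : ℕ | ∃ C : Set (Submodule F (Fin n → F)),
      m = C.ncard ∧ ∀ U : Submodule F (Fin n → F), ∃ V ∈ C, dI U V ≤ ρ}.Nonempty :=
    ⟨_, Set.univ, rfl, fun U => ⟨U, trivial, by rw [dI, inf_idem]; omega⟩⟩
  obtain ⟨C, hC, hcov⟩ := Nat.sInf_mem hne
  exact ⟨C, hC.symm, hcov⟩

lemma KI_pos (ρ : ℕ) : 0 < KI F n ρ := by
  obtain ⟨C, hC, hcov⟩ := exists_code_ncard_eq_KI (F := F) (n := n) ρ
  obtain ⟨V, hV, -⟩ := hcov ⊥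
  rw [← hC, Set.ncard_pos]
  exact ⟨V, hV⟩

lemma KI_two_mul_add_one (m : ℕ) : KI F (2 * m + 1) m = 2 := by
  apply le_antisymm
  · obtain ⟨C, hC⟩ := exists_submodule_finrank_eq (F := F) (n := 2 * m + 1) (k := m) (by omega)
    refine (KI_le_ncard {C, perp C} fun U => ?_).trans (Set.ncard_insert_le _ _ |>.trans (by simp))
    simpa using dI_le_or_dI_perp_le hC U
  · by_contra! h
    obtain ⟨S, hS, hcov⟩ := exists_code_ncard_eq_KI (F := F) (n := 2 * m + 1) m
    have hpos := KI_pos (F := F) (n := 2 * m + 1) m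
    obtain ⟨C, rfl⟩ := Set.ncard_eq_one.mp (show S.ncard = 1 by omega)
    obtain ⟨U, hU⟩ := exists_lt_dI C
    obtain ⟨V, rfl, hV⟩ := hcov U
    omega

end SubspaceCodes

theorem KI_large_radius (F : Type) [Field F] [Fintype F] :
    (∀ n ρ : ℕ, n - n / 2 ≤ ρ → ρ < n →
      (KI F n ρ = 1 ∧
        ∀ C : Submodule F (Fin n → F), finrank F ↥C = n / 2 →
          ∀ U : Submodule F (Fin n → F), dI U C ≤ ρ)) ∧
    (∀ m : ℕ,
      KI F (2 * m + 1) m = 2 ∧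
      (∀ C : Submodule F (Fin (2 * m + 1) → F), finrank F ↥C = m →
        ∀ U : Submodule F (Fin (2 * m + 1) → F), dI U C ≤ m ∨ dI U (perp C) ≤ m) ∧
      (∀ C : Submodule F (Fin (2 * m + 1) → F),
        ∃ U : Submodule F (Fin (2 * m + 1) → F), m < dI U C)) := by
  refine ⟨fun n ρ h _ => ?_, fun m => ⟨KI_two_mul_add_one m,
    fun _ hC => dI_le_or_dI_perp_le hC, exists_lt_dI⟩⟩
  have hcov : ∀ C : Submodule F (Fin n → F), finrank F ↥C = n / 2 →
      ∀ U : Submodule F (Fin n → F), dI U C ≤ ρ :=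
    fun C hC U => dI_le_of_finrank_le (by omega) (by omega)
  obtain ⟨C, hC⟩ := exists_submodule_finrank_eq (F := F) (Nat.div_le_self n 2)
  refine ⟨le_antisymm ?_ (KI_pos ρ), hcov⟩
  simpa using KI_le_ncard {C} fun U => ⟨C, rfl, hcov C hC U⟩
end
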